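/- arXiv:1307.4863 — 2 statements merged into one kernel-verified Lean document; each statement's English description precedes it below -/
import Mathlib

section
/- Let H be a complex Hilbert space, D a normed complex vector space, and ι : D → H a continuous injective linear map. Let T : ℂ → L(D,H) be analytic at λ₀ with Taylor expansion T(λ) = Σ_{m=0}^∞ Bₘ(λ−λ₀)ᵐ converging for |λ−λ₀| < r. Suppose N ≥ 1 is an integer and Cₙ ∈ L(H,D) for n ≥ −N are such that for all λ with 0 < |λ−λ₀| < r the series Σ_{n=−N}^∞ Cₙ(λ−λ₀)ⁿ converges in L(H,D) to an operator S(λ) satisfying T(λ) ∘ S(λ) = Id_H. Then Σ_{j=0}^{k} B_{k−j} ∘ C_{j−N} = 0 for every k = 0, 1, …, N−1, and consequently the range of C_{−n} is contained in sp(λ₀) for every n = 1, …, N. -/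
/-- The set of generalized (Keldysh) eigenstates associated to the Taylor coefficients
`B m` of an analytic family at a point: `u` belongs to it iff there are `k` and
`u₀, …, u_k` with `u_k = u` and `Σ_{j=0}^{i} B_{i−j} u_j = 0` for every `i = 0, …, k`. -/
def genEigenstates {D H : Type*} [NormedAddCommGroup D] [NormedSpace ℂ D]
    [NormedAddCommGroup H] [NormedSpace ℂ H] (B : ℕ → D →L[ℂ] H) : Set D :=
  {u | ∃ (k : ℕ) (v : ℕ → D), v k = u ∧ ∀ i ≤ k,
    ∑ j ∈ Finset.range (i + 1), (B (i - j)) (v j) = 0}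

/-- If `∑ wᵐ aₘ` converges at `w`, then it converges absolutely at every `z` with `‖z‖ < ‖w‖`. -/
theorem summable_norm_pow_smul_of_norm_lt {E : Type*} [NormedAddCommGroup E] [NormedSpace ℂ E]
    {a : ℕ → E} {z w : ℂ} (hzw : ‖z‖ < ‖w‖) (hw : Summable fun m => w ^ m • a m) :
    Summable fun m => ‖z ^ m • a m‖ := by
  have hw0 : 0 < ‖w‖ := (norm_nonneg z).trans_lt hzw
  obtain ⟨M, hM⟩ := hw.tendsto_atTop_zero.norm.bddAbove_range
  refine Summable.of_nonneg_of_le (fun _ => norm_nonneg _) (fun m => ?_)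
    ((summable_geometric_of_lt_one (by positivity) ((div_lt_one hw0).2 hzw)).mul_left M)
  have hm : ‖w ^ m • a m‖ ≤ M := hM ⟨m, rfl⟩
  calc ‖z ^ m • a m‖ = ‖w ^ m • a m‖ * (‖z‖ / ‖w‖) ^ m := by
        simp only [norm_smul, norm_pow, div_pow]
        field_simp
    _ ≤ M * (‖z‖ / ‖w‖) ^ m := by gcongr

/-- Cauchy product of two absolutely convergent series of operators; the domain of the outer
operators need not be complete. -/
theorem hasSum_comp_cauchyProduct {E F G : Type*} [NormedAddCommGroup E] [NormedSpace ℂ E]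
    [NormedAddCommGroup F] [NormedSpace ℂ F] [NormedAddCommGroup G] [NormedSpace ℂ G]
    [CompleteSpace G] {f : ℕ → F →L[ℂ] G} {g : ℕ → E →L[ℂ] F} {a : F →L[ℂ] G} {b : E →L[ℂ] F}
    (hf : HasSum f a) (hg : HasSum g b) (hf' : Summable fun m => ‖f m‖)
    (hg' : Summable fun m => ‖g m‖) :
    HasSum (fun k => ∑ j ∈ Finset.range (k + 1), (f (k - j)).comp (g j)) (a.comp b) := by
  have hsum : Summable fun p : ℕ × ℕ => (f p.1).comp (g p.2) :=
    Summable.of_norm_bounded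
      (hf'.mul_of_nonneg hg' (fun _ => norm_nonneg _) (fun _ => norm_nonneg _))
      fun p => (f p.1).opNorm_comp_le (g p.2)
  obtain ⟨c, hc⟩ := hsum
  have hrow : ∀ m, HasSum (fun n => (f m).comp (g n)) ((f m).comp b) := fun m =>
    hg.mapL (ContinuousLinearMap.compL ℂ E F G (f m))
  have hcol : HasSum (fun m => (f m).comp b) (a.comp b) :=
    hf.mapL ((ContinuousLinearMap.compL ℂ E F G).flip b)
  obtain rfl := (hc.prod_fiberwise hrow).unique hcol
  have hanti := (Finset.HasAntidiagonal.sigmaAntidiagonalEquivProd.hasSum_iff).2 hc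
  convert hanti.sigma fun k => hasSum_fintype _ using 1
  funext k
  rw [Finset.univ_eq_attach]
  exact (Finset.Nat.sum_antidiagonal_eq_sum_range_succ
      (fun j i => (f i).comp (g j)) k).symm.trans <|
    (Finset.Nat.sum_antidiagonal_swap (f := fun p : ℕ × ℕ => (f p.1).comp (g p.2))).trans
      (Finset.sum_attach _ fun p : ℕ × ℕ => (f p.1).comp (g p.2)).symm

/-- A power series that converges to zero on a punctured disc has zero coefficients. -/
theorem coeff_eq_zero_of_hasSum_zero {E : Type*} [NormedAddCommGroup E] [NormedSpace ℂ E]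
    {a : ℕ → E} {r : ℝ} (hr : 0 < r)
    (h : ∀ z : ℂ, 0 < ‖z‖ → ‖z‖ < r → HasSum (fun m => z ^ m • a m) 0) (k : ℕ) : a k = 0 := by
  let b : ℕ → E := fun n => Nat.casesOn n 0 a
  let p : FormalMultilinearSeries ℂ ℂ E := fun n => ContinuousMultilinearMap.mkPiRing ℂ (Fin n) (b n)
  have hp : HasFPowerSeriesAt (0 : ℂ → E) p 0 := by
    rw [hasFPowerSeriesAt_iff]
    filter_upwards [Metric.ball_mem_nhds (0 : ℂ) hr] with z hz
    have hb : (fun n => z ^ n • p.coeff n) = fun n => z ^ n • b n := by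
      ext n; simp [p, FormalMultilinearSeries.coeff]
    rw [hb, ← hasSum_nat_add_iff' 1]
    rcases eq_or_ne z 0 with rfl | hz0
    · simp [b]
    · simpa [b, pow_succ', mul_smul] using
        (h z (norm_pos_iff.2 hz0) (by simpa using hz)).const_smul z
  have h0 : p.coeff (k + 1) = 0 := by
    rw [hp.eq_zero]; rfl
  simpa [p, b, FormalMultilinearSeries.coeff] using h0

/-- If `T(λ) = Σ Bₘ(λ−l₀)ᵐ` is analytic at `l₀` and `S(λ) = Σ_{n≥−N} Cₙ(λ−l₀)ⁿ` is a
meromorphic right inverse of `T` near `l₀`, then `Σ_{j=0}^{k} B_{k−j} ∘ C_{j−N} = 0` for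
`k = 0, …, N−1`, and the range of each `C_{−n}`, `1 ≤ n ≤ N`, consists of generalized
eigenstates of `T` at `l₀`. -/
theorem laurent_principal_part_maps_into_genEigenstates
    {H : Type*} [NormedAddCommGroup H] [InnerProductSpace ℂ H] [CompleteSpace H]
    {D : Type*} [NormedAddCommGroup D] [NormedSpace ℂ D]
    (ι : D →L[ℂ] H) (hι : Function.Injective ι)
    (T : ℂ → D →L[ℂ] H) (l₀ : ℂ) (B : ℕ → D →L[ℂ] H) (r : ℝ) (hr : 0 < r)
    (hTB : ∀ lam : ℂ, ‖lam - l₀‖ < r →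
      HasSum (fun m : ℕ => (lam - l₀) ^ m • B m) (T lam))
    (N : ℕ) (hN : 1 ≤ N) (Cn : ℤ → H →L[ℂ] D) (S : ℂ → H →L[ℂ] D)
    (hS : ∀ lam : ℂ, 0 < ‖lam - l₀‖ → ‖lam - l₀‖ < r →
      HasSum (fun m : ℕ => (lam - l₀) ^ ((m : ℤ) - N) • Cn ((m : ℤ) - N)) (S lam))
    (hTS : ∀ lam : ℂ, 0 < ‖lam - l₀‖ → ‖lam - l₀‖ < r →
      (T lam).comp (S lam) = ContinuousLinearMap.id ℂ H) :
    (∀ k < N, ∑ j ∈ Finset.range (k + 1),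
      (B (k - j)).comp (Cn ((j : ℤ) - N)) = 0) ∧
    ∀ n : ℕ, 1 ≤ n → n ≤ N → ∀ f : H, Cn (-(n : ℤ)) f ∈ genEigenstates B := by
  have hE : ∀ z : ℂ, 0 < ‖z‖ → ‖z‖ < r →
      HasSum (fun k => z ^ k • (∑ j ∈ Finset.range (k + 1), (B (k - j)).comp (Cn ((j : ℤ) - N))
        - if k = N then ContinuousLinearMap.id ℂ H else 0)) 0 := by
    have hT : ∀ z : ℂ, ‖z‖ < r → HasSum (fun m : ℕ => z ^ m • B m) (T (l₀ + z)) := fun z hz => by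
      simpa using hTB (l₀ + z) (by simpa using hz)
    have hC : ∀ z : ℂ, 0 < ‖z‖ → ‖z‖ < r →
        HasSum (fun m : ℕ => z ^ m • Cn ((m : ℤ) - N)) (z ^ N • S (l₀ + z)) := fun z hz hzr => by
      have hz0 : z ≠ 0 := norm_pos_iff.1 hz
      have := (hS (l₀ + z) (by simpa using hz) (by simpa using hzr)).const_smul (z ^ N)
      simpa [smul_smul, zpow_sub₀ hz0, mul_div_cancel₀, hz0] using this
    intro z hz hzr
    obtain ⟨ρ, hzρ, hρr⟩ := exists_between hzr
    have hρ0 : 0 < ρ := hz.trans hzρ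
    have hρ : ‖(ρ : ℂ)‖ = ρ := by simp [hρ0.le]
    have hT' : Summable fun m => ‖z ^ m • B m‖ :=
      summable_norm_pow_smul_of_norm_lt (E := D →L[ℂ] H) (a := B) (w := ρ)
        (by rwa [hρ]) (hT ρ (by rwa [hρ])).summable
    have hC' : Summable fun m : ℕ => ‖z ^ m • Cn ((m : ℤ) - N)‖ :=
      summable_norm_pow_smul_of_norm_lt (E := H →L[ℂ] D) (a := fun m : ℕ => Cn ((m : ℤ) - N))
        (w := ρ) (by rwa [hρ]) (hC ρ (by rwa [hρ]) (by rwa [hρ])).summable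
    have hprod := hasSum_comp_cauchyProduct (hT z hzr) (hC z hz hzr) hT' hC'
    rw [ContinuousLinearMap.comp_smul,
      hTS (l₀ + z) (by simpa using hz) (by simpa using hzr)] at hprod
    have hid : HasSum (fun k => z ^ k • if k = N then ContinuousLinearMap.id ℂ H else 0)
        (z ^ N • ContinuousLinearMap.id ℂ H) := by
      convert hasSum_ite_eq N (z ^ N • ContinuousLinearMap.id ℂ H) using 2 with k
      split_ifs with h <;> simp [h]
    have hdiff := hprod.sub hid
    rw [sub_self] at hdiff
    refine hdiff.congr_fun fun k => ?_
    rw [smul_sub, Finset.smul_sum]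
    congr 1
    refine Finset.sum_congr rfl fun j hj => ?_
    rw [ContinuousLinearMap.comp_smul, ContinuousLinearMap.smul_comp, smul_smul, ← pow_add,
      Nat.add_sub_cancel' (Finset.mem_range_succ_iff.1 hj)]
  have hcoeff : ∀ k < N, ∑ j ∈ Finset.range (k + 1),
      (B (k - j)).comp (Cn ((j : ℤ) - N)) = 0 := fun k hk => by
    simpa [hk.ne] using coeff_eq_zero_of_hasSum_zero hr hE k
  refine ⟨hcoeff, fun n hn hnN f => ⟨N - n, fun j => Cn ((j : ℤ) - N) f, ?_, fun i hi => ?_⟩⟩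
  · have : ((N - n : ℕ) : ℤ) - N = -n := by omega
    simp only [this]
  · simpa using congrArg (fun A : H →L[ℂ] H => A f) (hcoeff i (by omega))
end

section
/- Let H be a complex Hilbert space and A₀, A₁, A₂ ∈ L(H) with A₂ invertible; set T(λ) = A₀ + λA₁ + λ²A₂ and let 𝒜 be the associated block operator on H × H. Then for every λ ∈ ℂ: T(λ) is bijective if and only if 𝒜 − λ·Id is bijective, and in that case (𝒜 − λ)⁻¹(f,g) = ( −T(λ)⁻¹(A₁ + λA₂)f − T(λ)⁻¹g , (A₂ − A₂T(λ)⁻¹(λA₁ + λ²A₂))f − λ·A₂T(λ)⁻¹g ) for all (f,g) ∈ H × H, and the operator norms satisfy ‖T(λ)⁻¹‖ ≤ ‖(𝒜 − λ)⁻¹‖. -/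
noncomputable section

/-- The quadratic operator pencil `T(λ) = A₀ + λA₁ + λ²A₂`. -/
def pencil {H : Type*} [NormedAddCommGroup H] [InnerProductSpace ℂ H]
    (A₀ A₁ A₂ : H →L[ℂ] H) (lam : ℂ) : H →L[ℂ] H :=
  A₀ + lam • A₁ + lam ^ 2 • A₂

/-- The block operator `(u,v) ↦ (A₂⁻¹v, −A₀u − A₁A₂⁻¹v)` on the plain product `H × H`,
`B₂` being the inverse of `A₂`. -/
def blockOpPlain {H : Type*} [NormedAddCommGroup H] [InnerProductSpace ℂ H]
    (A₀ A₁ B₂ : H →L[ℂ] H) : (H × H) →L[ℂ] (H × H) :=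
  (B₂.comp (ContinuousLinearMap.snd ℂ H H)).prod
    (-(A₀.comp (ContinuousLinearMap.fst ℂ H H)) -
      (A₁.comp B₂).comp (ContinuousLinearMap.snd ℂ H H))

/-- The block operator `𝒜` regarded as an operator on `H × H` equipped with the Hilbert
norm `‖(u,v)‖² = ‖u‖² + ‖v‖²` (i.e. on `WithLp 2 (H × H)`). -/
def blockOp {H : Type*} [NormedAddCommGroup H] [InnerProductSpace ℂ H]
    (A₀ A₁ B₂ : H →L[ℂ] H) : WithLp 2 (H × H) →L[ℂ] WithLp 2 (H × H) :=
  ((WithLp.prodContinuousLinearEquiv 2 ℂ H H).symm.toContinuousLinearMap.comp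
    ((blockOpPlain A₀ A₁ B₂).comp
      (WithLp.prodContinuousLinearEquiv 2 ℂ H H).toContinuousLinearMap))

/-- The resolvent equation for the block operator reduces to an equation for the pencil: its
second component is eliminated by `v = A₂ (f + λ u)`. -/
lemma blockOp_sub_smul_apply_eq_iff {H : Type*} [NormedAddCommGroup H] [InnerProductSpace ℂ H]
    (A₀ A₁ A₂ B₂ : H →L[ℂ] H) (hB₂l : ∀ x, B₂ (A₂ x) = x) (hB₂r : ∀ x, A₂ (B₂ x) = x) (lam : ℂ)
    (x y : WithLp 2 (H × H)) :
    (blockOp A₀ A₁ B₂ - lam • (1 : WithLp 2 (H × H) →L[ℂ] WithLp 2 (H × H))) x = y ↔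
      x.snd = A₂ (y.fst + lam • x.fst) ∧
        pencil A₀ A₁ A₂ lam x.fst = -(A₁ + lam • A₂) y.fst - y.snd := by
  have hfst : ((blockOp A₀ A₁ B₂ -
      lam • (1 : WithLp 2 (H × H) →L[ℂ] WithLp 2 (H × H))) x).fst =
      B₂ x.snd - lam • x.fst := rfl
  have hsnd : ((blockOp A₀ A₁ B₂ -
      lam • (1 : WithLp 2 (H × H) →L[ℂ] WithLp 2 (H × H))) x).snd =
      -A₀ x.fst - A₁ (B₂ x.snd) - lam • x.snd := rfl
  have hy : (blockOp A₀ A₁ B₂ - lam • (1 : WithLp 2 (H × H) →L[ℂ] WithLp 2 (H × H))) x = y ↔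
      B₂ x.snd - lam • x.fst = y.fst ∧
        -A₀ x.fst - A₁ (B₂ x.snd) - lam • x.snd = y.snd := by
    rw [← hfst, ← hsnd, ← (WithLp.ofLp_injective 2).eq_iff]
    exact Prod.ext_iff
  have hv : B₂ x.snd - lam • x.fst = y.fst ↔ x.snd = A₂ (y.fst + lam • x.fst) := by
    rw [sub_eq_iff_eq_add]
    exact ⟨fun h => by rw [← h, hB₂r], fun h => by rw [h, hB₂l]⟩
  rw [hy, hv]
  refine and_congr_right fun h => ?_
  rw [h, hB₂l]
  simp only [pencil, add_apply, smul_apply,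
    map_add, map_smul]
  constructor <;> intro e
  · rw [← e]; module
  · rw [← sub_eq_zero] at e ⊢
    rw [← neg_eq_zero, ← e]; module

/-- Linearization of the pencil: `T(λ)` is bijective iff `𝒜 − λ` is; in that case the
inverse of `𝒜 − λ` is given by the explicit 2×2 block formula, and
`‖T(λ)⁻¹‖ ≤ ‖(𝒜 − λ)⁻¹‖`. -/
theorem pencil_linearization {H : Type*} [NormedAddCommGroup H] [InnerProductSpace ℂ H]
    [CompleteSpace H] (A₀ A₁ A₂ B₂ : H →L[ℂ] H)
    (hB₂l : ∀ x, B₂ (A₂ x) = x) (hB₂r : ∀ x, A₂ (B₂ x) = x) (lam : ℂ) :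
    (Function.Bijective (pencil A₀ A₁ A₂ lam) ↔
      Function.Bijective (blockOp A₀ A₁ B₂ - lam • (1 : WithLp 2 (H × H) →L[ℂ] WithLp 2 (H × H)))) ∧
    ∀ Tinv : H →L[ℂ] H, (∀ u, Tinv (pencil A₀ A₁ A₂ lam u) = u) →
      (∀ f, pencil A₀ A₁ A₂ lam (Tinv f) = f) →
      ∀ Ainv : WithLp 2 (H × H) →L[ℂ] WithLp 2 (H × H),
        (∀ x, Ainv ((blockOp A₀ A₁ B₂ - lam • (1 : WithLp 2 (H × H) →L[ℂ] WithLp 2 (H × H))) x) = x) →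
        (∀ x, (blockOp A₀ A₁ B₂ - lam • (1 : WithLp 2 (H × H) →L[ℂ] WithLp 2 (H × H))) (Ainv x) = x) →
        (∀ f g : H,
          Ainv ((WithLp.prodContinuousLinearEquiv 2 ℂ H H).symm (f, g)) =
            (WithLp.prodContinuousLinearEquiv 2 ℂ H H).symm
              (-(Tinv ((A₁ + lam • A₂) f)) - Tinv g,
                (A₂ f - A₂ (Tinv ((lam • A₁ + lam ^ 2 • A₂) f))) - lam • A₂ (Tinv g))) ∧
        ‖Tinv‖ ≤ ‖Ainv‖ := by
  have key := blockOp_sub_smul_apply_eq_iff A₀ A₁ A₂ B₂ hB₂l hB₂r lam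
  refine ⟨?_, ?_⟩
  · simp only [Function.bijective_iff_existsUnique]
    constructor
    · intro h y
      obtain ⟨u, hu, huniq⟩ := h (-(A₁ + lam • A₂) y.fst - y.snd)
      refine ⟨WithLp.toLp 2 (u, A₂ (y.fst + lam • u)), (key _ _).2 ⟨rfl, hu⟩, fun x hx => ?_⟩
      obtain ⟨h1, h2⟩ := (key _ _).1 hx
      have h3 : x.fst = u := huniq _ h2
      rw [h3] at h1
      exact WithLp.ofLp_injective 2 (Prod.ext h3 h1)
    · intro h w
      obtain ⟨x, hx, huniq⟩ := h (WithLp.toLp 2 (0, -w))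
      refine ⟨x.fst, by simpa using ((key _ _).1 hx).2, fun u hu => ?_⟩
      have := huniq (WithLp.toLp 2 (u, A₂ (0 + lam • u)))
        ((key _ _).2 ⟨rfl, by simpa using hu⟩)
      exact congrArg WithLp.fst this
  · intro Tinv _ hTr Ainv hAl _
    have formula : ∀ f g : H,
        Ainv ((WithLp.prodContinuousLinearEquiv 2 ℂ H H).symm (f, g)) =
          (WithLp.prodContinuousLinearEquiv 2 ℂ H H).symm
            (-(Tinv ((A₁ + lam • A₂) f)) - Tinv g,
              (A₂ f - A₂ (Tinv ((lam • A₁ + lam ^ 2 • A₂) f))) - lam • A₂ (Tinv g)) := by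
      intro f g
      have hinv : (blockOp A₀ A₁ B₂ - lam • (1 : WithLp 2 (H × H) →L[ℂ] WithLp 2 (H × H)))
          (WithLp.toLp 2 (-(Tinv ((A₁ + lam • A₂) f)) - Tinv g,
            (A₂ f - A₂ (Tinv ((lam • A₁ + lam ^ 2 • A₂) f))) - lam • A₂ (Tinv g))) =
          WithLp.toLp 2 (f, g) := by
        refine (key _ _).2 ⟨?_, ?_⟩
        · simp only [WithLp.toLp_fst, WithLp.toLp_snd, add_apply, smul_apply, map_add, map_smul,
            map_sub, map_neg]
          module
        · simp only [WithLp.toLp_fst, WithLp.toLp_snd, map_sub, map_neg, hTr]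
      exact (congrArg Ainv hinv.symm).trans (hAl _)
    refine ⟨formula, Tinv.opNorm_le_bound (norm_nonneg _) fun g => ?_⟩
    have hfst : (Ainv (WithLp.toLp 2 (0, g))).fst = -Tinv g := by
      have := congrArg WithLp.fst (formula 0 g)
      simpa using this
    calc ‖Tinv g‖ = ‖(Ainv (WithLp.toLp 2 (0, g))).fst‖ := by rw [hfst, norm_neg]
      _ ≤ ‖Ainv (WithLp.toLp 2 (0, g))‖ := WithLp.norm_fst_le _ _
      _ ≤ ‖Ainv‖ * ‖WithLp.toLp 2 ((0 : H), g)‖ := Ainv.le_opNorm _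
      _ = ‖Ainv‖ * ‖g‖ := by rw [WithLp.norm_toLp_snd]
end
end
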